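/- Let f^opt ≥ 0 satisfy f_i ≤ f^opt for all i ∈ 𝓕, and let (x,y) be a fractional solution of the strengthened knapsack-median LP (K-P) with parameter C^opt. Then there exist a set F ⊆ 𝓕 with ∑_{i∈F} w_i ≤ B and an assignment σ : 𝓓 → F such that ∑_{i∈F} f_i + ∑_{j∈𝓓} d_j c(σ(j), j) ≤ 28·(∑_i f_i y_i + ∑_{j}∑_i d_j c(i,j) x_{ij}) + f^opt + 4·C^opt. -/

import Mathlib

open scoped Classical
open Finset

lemma km_shift {ι : Type*} [Fintype ι] (p e : ι → ℝ) (hp : ∀ i, 0 ≤ p i)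
    (hs : ∀ i, e i ≠ 0 → 0 < p i) (hneg : ∃ i, e i < 0) :
    ∃ ε : ℝ, 0 < ε ∧ (∀ i, 0 ≤ p i + ε * e i) ∧ ∃ i, 0 < p i ∧ p i + ε * e i = 0 := by
  obtain ⟨i0, hi0⟩ := hneg
  obtain ⟨m, hm, hmin⟩ := Finset.exists_min_image (univ.filter fun i => e i < 0)
    (fun i => p i / (-e i)) ⟨i0, by simp [hi0]⟩
  simp only [mem_filter, mem_univ, true_and] at hm hmin
  have hpm := hs m hm.ne
  refine ⟨p m / (-e m), div_pos hpm (by linarith), ?_, m, hpm, ?_⟩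
  · intro i
    rcases lt_or_ge (e i) 0 with h | h
    · have h1 := hmin i h
      have h2 : (p m / (-e m)) * (-e i) ≤ p i := by
        rwa [le_div_iff₀ (by linarith)] at h1
      linarith
    · have := mul_nonneg (div_pos hpm (by linarith : 0 < -e m)).le h
      linarith [hp i]
  · have : e m ≠ 0 := hm.ne
    field_simp
    ring

lemma km_choice {Γ O : Type*} [Fintype Γ] [Fintype O] [Nonempty Γ] (w cost : Γ → O → ℝ)
    (hc : ∀ g o, 0 ≤ cost g o) (n : ℕ) :
    ∀ p : Γ → O → ℝ, (∀ g o, 0 ≤ p g o) → (∀ g, ∑ o, p g o = 1) →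
      (univ.filter fun q : Γ × O => 0 < p q.1 q.2).card ≤ n →
      ∃ o : Γ → O, (∀ g, 0 < p g (o g)) ∧
        ∑ g, w g (o g) ≤ ∑ g, ∑ o, p g o * w g o ∧
        ∃ g0, ∑ g ∈ univ.erase g0, cost g (o g) ≤ ∑ g, ∑ o, p g o * cost g o := by
  induction n with
  | zero =>
    intro p hp h1 hcard
    exfalso
    obtain ⟨g⟩ := ‹Nonempty Γ›
    have : ∃ o, 0 < p g o := by
      by_contra! h
      have : ∑ o, p g o ≤ 0 := Finset.sum_nonpos fun o _ => h o
      linarith [h1 g]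
    obtain ⟨o, ho⟩ := this
    have h0 : (univ.filter fun q : Γ × O => 0 < p q.1 q.2) = ∅ := by
      simpa using hcard
    have : (g, o) ∈ (univ.filter fun q : Γ × O => 0 < p q.1 q.2) := by simpa using ho
    rw [h0] at this
    simp at this
  | succ n ih =>
    intro p hp h1 hcard
    have hex : ∀ g, ∃ o, 0 < p g o := by
      intro g
      by_contra! h
      have : ∑ o, p g o ≤ 0 := Finset.sum_nonpos fun o _ => h o
      linarith [h1 g]
    by_cases H : ∃ g h, g ≠ h ∧ (∃ a b, a ≠ b ∧ 0 < p g a ∧ 0 < p g b) ∧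
        (∃ a b, a ≠ b ∧ 0 < p h a ∧ 0 < p h b)
    · obtain ⟨g, h, hgh, ⟨a, b, hab, ha, hb⟩, ⟨a', b', hab', ha', hb'⟩⟩ := H
      -- direction
      obtain ⟨s, t, hst, hw0, hc0⟩ : ∃ s t : ℝ, (s ≠ 0 ∨ t ≠ 0) ∧
          s * (w g a - w g b) + t * (w h a' - w h b') = 0 ∧
          s * (cost g a - cost g b) + t * (cost h a' - cost h b') ≤ 0 := by
        obtain ⟨s, t, hst, hw0⟩ : ∃ s t : ℝ, (s ≠ 0 ∨ t ≠ 0) ∧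
          s * (w g a - w g b) + t * (w h a' - w h b') = 0 := by
          by_cases hz : w g a - w g b = 0
          · exact ⟨1, 0, by simp, by simp [hz]⟩
          · exact ⟨-(w h a' - w h b'), w g a - w g b, Or.inr hz, by ring⟩
        rcases le_total (s * (cost g a - cost g b) + t * (cost h a' - cost h b')) 0 with hl | hl
        · exact ⟨s, t, hst, hw0, hl⟩
        · exact ⟨-s, -t, by simpa using hst, by linarith, by linarith⟩
      let e : Γ → O → ℝ := fun k o =>
        (if k = g then (if o = a then s else 0) - (if o = b then s else 0) else 0) +
        (if k = h then (if o = a' then t else 0) - (if o = b' then t else 0) else 0)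
      have esum : ∀ r : Γ → O → ℝ, ∑ k, ∑ o, e k o * r k o =
          s * (r g a - r g b) + t * (r h a' - r h b') := by
        intro r
        have : ∀ k, ∑ o, e k o * r k o =
            (if k = g then s * (r k a - r k b) else 0) +
            (if k = h then t * (r k a' - r k b') else 0) := by
          intro k
          simp only [e]
          by_cases h1 : k = g <;> by_cases h2 : k = h <;>
            simp [h1, h2, add_mul, sub_mul, Finset.sum_add_distrib, Finset.sum_sub_distrib,
              ite_mul] <;> ring_nf
        simp only [this, Finset.sum_add_distrib]
        simp
      have esum0 : ∀ k, ∑ o, e k o = 0 := by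
        intro k
        simp only [e]
        by_cases h1 : k = g <;> by_cases h2 : k = h <;>
          simp [h1, h2, Finset.sum_add_distrib, Finset.sum_sub_distrib]
      have hsupp : ∀ k o, e k o ≠ 0 → 0 < p k o := by
        intro k o hne
        by_contra hno
        apply hne
        simp only [e]
        by_cases h1 : k = g
        · have h2 : k ≠ h := by rw [h1]; exact hgh
          subst h1
          have : o ≠ a := by rintro rfl; exact hno ha
          have : o ≠ b := by rintro rfl; exact hno hb
          simp [*]
        · by_cases h2 : k = h
          · subst h2
            have : o ≠ a' := by rintro rfl; exact hno ha'
            have : o ≠ b' := by rintro rfl; exact hno hb'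
            simp [*]
          · simp [h1, h2]
      have hneg : ∃ q : Γ × O, e q.1 q.2 < 0 := by
        rcases hst with h0 | h0
        · have e1 : e g a = s := by simp [e, hgh, hab]
          have e2 : e g b = -s := by simp [e, hgh, hab.symm]
          rcases lt_or_gt_of_ne h0 with h | h
          · exact ⟨(g, a), by simpa [e1] using h⟩
          · exact ⟨(g, b), by simpa [e2] using h⟩
        · have e1 : e h a' = t := by simp [e, hgh.symm, hab']
          have e2 : e h b' = -t := by simp [e, hgh.symm, hab'.symm]
          rcases lt_or_gt_of_ne h0 with h' | h'
          · exact ⟨(h, a'), by simpa [e1] using h'⟩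
          · exact ⟨(h, b'), by simpa [e2] using h'⟩
      obtain ⟨ε, hε, hnn, ⟨q, hq, hq0⟩⟩ := km_shift (fun q : Γ × O => p q.1 q.2)
        (fun q => e q.1 q.2) (fun q => hp _ _) (fun q => hsupp _ _) hneg
      have hsum : ∀ r : Γ → O → ℝ, ∑ k, ∑ o, (p k o + ε * e k o) * r k o =
          ∑ k, ∑ o, p k o * r k o + ε * (s * (r g a - r g b) + t * (r h a' - r h b')) := by
        intro r
        rw [← esum r]
        simp only [Finset.mul_sum, ← Finset.sum_add_distrib]
        refine Finset.sum_congr rfl fun k _ => Finset.sum_congr rfl fun o _ => by ring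
      have hsub : ∀ k o, 0 < p k o + ε * e k o → 0 < p k o := by
        intro k o hpos
        by_cases h0 : e k o = 0
        · simpa [h0] using hpos
        · exact hsupp k o h0
      obtain ⟨o, ho1, ho2, g0, ho3⟩ := ih (fun k o => p k o + ε * e k o)
        (fun k o => hnn (k, o)) (by
          intro k
          rw [Finset.sum_add_distrib, ← Finset.mul_sum, esum0, h1]; simp) (by
          refine Nat.lt_succ_iff.mp (lt_of_lt_of_le (Finset.card_lt_card ?_) hcard)
          refine Finset.ssubset_iff_subset_ne.mpr ⟨?_, ?_⟩
          · intro q' hq'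
            simp only [mem_filter, mem_univ, true_and] at hq' ⊢
            exact hsub _ _ hq'
          · intro heq
            have : q ∈ (univ.filter fun q : Γ × O => 0 < p q.1 q.2) := by simpa using hq
            rw [← heq] at this
            simp only [mem_filter, mem_univ, true_and] at this
            linarith)
      refine ⟨o, fun k => hsub _ _ (ho1 k), ?_, g0, ?_⟩
      · rw [hsum, hw0] at ho2
        linarith
      · rw [hsum] at ho3
        nlinarith
    · -- at most one fractional group
      have hdet : ∃ g0, ∀ g, g ≠ g0 → ∀ a b, 0 < p g a → 0 < p g b → a = b := by
        by_cases H2 : ∃ g a b, a ≠ b ∧ 0 < p g a ∧ 0 < p g b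
        · obtain ⟨g, a, b, hab⟩ := H2
          refine ⟨g, fun k hk a' b' ha' hb' => ?_⟩
          by_contra hne
          exact H ⟨g, k, hk.symm, ⟨a, b, hab⟩, ⟨a', b', hne, ha', hb'⟩⟩
        · obtain ⟨g⟩ := ‹Nonempty Γ›
          refine ⟨g, fun k hk a' b' ha' hb' => ?_⟩
          by_contra hne
          exact H2 ⟨k, a', b', hne, ha', hb'⟩
      obtain ⟨g0, hg0⟩ := hdet
      have hmin : ∀ g, ∃ o, 0 < p g o ∧ ∀ o', 0 < p g o' → w g o ≤ w g o' := by
        intro g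
        obtain ⟨o, ho, hmin⟩ := Finset.exists_min_image (univ.filter fun o => 0 < p g o)
          (fun o => w g o) (by obtain ⟨o, ho⟩ := hex g; exact ⟨o, by simpa using ho⟩)
        simp only [mem_filter, mem_univ, true_and] at ho hmin
        exact ⟨o, ho, hmin⟩
      choose o ho homin using hmin
      refine ⟨o, ho, ?_, g0, ?_⟩
      · refine Finset.sum_le_sum fun g _ => ?_
        calc w g (o g) = ∑ o', p g o' * w g (o g) := by
              rw [← Finset.sum_mul, h1, one_mul]
          _ ≤ _ := by
              refine Finset.sum_le_sum fun o' _ => ?_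
              rcases (hp g o').eq_or_lt with h | h
              · simp [← h]
              · exact mul_le_mul_of_nonneg_left (homin g o' h) h.le
      · calc ∑ g ∈ univ.erase g0, cost g (o g)
            = ∑ g ∈ univ.erase g0, ∑ o', p g o' * cost g o' := by
              refine Finset.sum_congr rfl fun g hg => ?_
              have hne : g ≠ g0 := Finset.ne_of_mem_erase hg
              have hz : ∀ o', p g o' * cost g o' = p g o' * cost g (o g) := by
                intro o'
                rcases (hp g o').eq_or_lt with h | h
                · simp [← h]
                · rw [hg0 g hne o' (o g) h (ho g)]
              simp only [hz]
              rw [← Finset.sum_mul, h1, one_mul]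
          _ ≤ _ := by
              refine Finset.sum_le_sum_of_subset_of_nonneg (Finset.erase_subset _ _) ?_
              intro g _ _
              exact Finset.sum_nonneg fun o _ => mul_nonneg (hp _ _) (hc _ _)

lemma km_color {D : Type*} (A : Finset D) (c : D → D → ℝ)
    (hsymm : ∀ j k, c j k = c k j) (n : D → D)
    (hn : ∀ j ∈ A, ∀ k ∈ A, k ≠ j → n j ∈ A ∧ n j ≠ j ∧ c j (n j) ≤ c j k) :
    ∃ χ : D → Bool, ∀ j ∈ A, ∀ k ∈ A, k ≠ j →
      ∃ l ∈ A, χ l ≠ χ j ∧ c j l ≤ c j (n j) := by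
  suffices H : ∀ (N : ℕ) (P : Finset D) (χ : D → Bool), P ⊆ A → (A \ P).card ≤ N →
      (∀ j ∈ P, ∀ k ∈ A, k ≠ j → ∃ l ∈ P, χ l ≠ χ j ∧ c j l ≤ c j (n j)) →
      ∃ χ : D → Bool, ∀ j ∈ A, ∀ k ∈ A, k ≠ j →
        ∃ l ∈ A, χ l ≠ χ j ∧ c j l ≤ c j (n j) by
    exact H _ ∅ (fun _ => false) (by simp) le_rfl (by simp)
  intro N
  induction N with
  | zero =>
    intro P χ hPA hcard hP
    have : A \ P = ∅ := by simpa using hcard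
    have hAP : A ⊆ P := Finset.sdiff_eq_empty_iff_subset.mp this
    obtain rfl := Finset.Subset.antisymm hPA hAP
    exact ⟨χ, hP⟩
  | succ N ih =>
    intro P χ hPA hcard hP
    by_cases hne : (A \ P).Nonempty
    · obtain ⟨j, hj, hmin⟩ := Finset.exists_min_image (A \ P) (fun j => c j (n j)) hne
      have hjA : j ∈ A := (Finset.mem_sdiff.mp hj).1
      have hjP : j ∉ P := (Finset.mem_sdiff.mp hj).2
      by_cases hk : ∃ k ∈ A, k ≠ j
      · obtain ⟨k, hkA, hkj⟩ := hk
        obtain ⟨hnA, hnj, -⟩ := hn j hjA k hkA hkj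
        by_cases hnP : n j ∈ P
        · refine ih (insert j P) (Function.update χ j (!χ (n j))) ?_ ?_ ?_
          · exact Finset.insert_subset hjA hPA
          · have : A \ insert j P ⊂ A \ P := by
              refine Finset.ssubset_iff_subset_ne.mpr ⟨Finset.sdiff_subset_sdiff le_rfl
                (Finset.subset_insert _ _), fun h => ?_⟩
              rw [← h] at hj; simp at hj
            have := Finset.card_lt_card this
            omega
          · intro i hi k' hk' hne'
            rcases Finset.mem_insert.mp hi with rfl | hiP
            · exact ⟨n i, by simp [hnP], by simp [hnj], le_rfl⟩
            · obtain ⟨l, hl, hχ, hcl⟩ := hP i hiP k' hk' hne'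
              have h1 : l ≠ j := by rintro rfl; exact hjP hl
              have h2 : i ≠ j := by rintro rfl; exact hjP hiP
              exact ⟨l, by simp [hl], by simpa [h1, h2] using hχ, hcl⟩
        · have hnm : n j ∈ A \ P := Finset.mem_sdiff.mpr ⟨hnA, hnP⟩
          refine ih (insert j (insert (n j) P))
            (Function.update (Function.update χ j true) (n j) false) ?_ ?_ ?_
          · exact Finset.insert_subset hjA (Finset.insert_subset hnA hPA)
          · have : A \ insert j (insert (n j) P) ⊂ A \ P := by
              refine Finset.ssubset_iff_subset_ne.mpr ⟨Finset.sdiff_subset_sdiff le_rfl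
                ((Finset.subset_insert _ _).trans (Finset.subset_insert _ _)), fun h => ?_⟩
              rw [← h] at hj; simp at hj
            have := Finset.card_lt_card this
            omega
          · intro i hi k' hk' hne'
            rcases Finset.mem_insert.mp hi with rfl | hi
            · exact ⟨n i, by simp, by simp [hnj.symm], le_rfl⟩
            rcases Finset.mem_insert.mp hi with rfl | hiP
            · refine ⟨j, by simp, by simp [hnj.symm], ?_⟩
              rw [hsymm]
              exact hmin _ hnm
            · obtain ⟨l, hl, hχ, hcl⟩ := hP i hiP k' hk' hne'
              have h1 : l ≠ j := by rintro rfl; exact hjP hl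
              have h2 : i ≠ j := by rintro rfl; exact hjP hiP
              have h3 : l ≠ n j := by rintro rfl; exact hnP hl
              have h4 : i ≠ n j := by rintro rfl; exact hnP hiP
              exact ⟨l, by simp [hl], by simpa [h1, h2, h3, h4] using hχ, hcl⟩
      · push Not at hk
        refine ⟨χ, fun i hi k hkA hki => ?_⟩
        exact absurd ((hk k hkA).trans (hk i hi).symm) hki
    · refine ih P χ hPA ?_ hP
      rw [Finset.not_nonempty_iff_eq_empty] at hne
      simp [hne]

lemma km_cluster {D : Type*} [Fintype D] (C : D → ℝ) (c : D → D → ℝ)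
    (hsymm : ∀ j k, c j k = c k j) (hself : ∀ j, c j j ≤ 4 * C j) :
    ∃ (A : Finset D) (a : D → D), (∀ k, a k ∈ A) ∧ (∀ k, C (a k) ≤ C k) ∧
      (∀ k, c (a k) k ≤ 4 * C k) ∧ (∀ j ∈ A, ∀ k ∈ A, k ≠ j → 4 * C j < c j k) := by
  suffices H : ∀ S : Finset D, ∃ (A : Finset D) (a : D → D), A ⊆ S ∧ (∀ k ∈ S, a k ∈ A) ∧
      (∀ k ∈ S, C (a k) ≤ C k) ∧ (∀ k ∈ S, c (a k) k ≤ 4 * C k) ∧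
      (∀ j ∈ A, ∀ k ∈ A, k ≠ j → 4 * C j < c j k) by
    obtain ⟨A, a, _, h1, h2, h3, h4⟩ := H univ
    exact ⟨A, a, fun k => h1 k (mem_univ _), fun k => h2 k (mem_univ _),
      fun k => h3 k (mem_univ _), h4⟩
  intro S
  induction S using Finset.induction_on_max_value C with
  | empty => exact ⟨∅, id, by simp, by simp, by simp, by simp, by simp⟩
  | insert j S hjS hmax ih =>
    obtain ⟨A, a, hA, h1, h2, h3, h4⟩ := ih
    have hne : ∀ k ∈ S, k ≠ j := by rintro k hk rfl; exact hjS hk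
    by_cases hex : ∃ k ∈ A, c k j ≤ 4 * C j
    · obtain ⟨k, hkA, hkc⟩ := hex
      refine ⟨A, Function.update a j k, hA.trans (Finset.subset_insert _ _), ?_, ?_, ?_, h4⟩ <;>
      · intro i hi
        rcases Finset.mem_insert.mp hi with rfl | hiS
        · simp [hkA, hkc, hmax k (hA hkA)]
        · simp [hne i hiS, h1 i hiS, h2 i hiS, h3 i hiS]
    · push Not at hex
      refine ⟨insert j A, Function.update a j j, Finset.insert_subset_insert _ hA,
        ?_, ?_, ?_, ?_⟩
      · intro i hi
        rcases Finset.mem_insert.mp hi with rfl | hiS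
        · simp
        · simp [hne i hiS, h1 i hiS]
      · intro i hi
        rcases Finset.mem_insert.mp hi with rfl | hiS
        · simp
        · simp [hne i hiS, h2 i hiS]
      · intro i hi
        rcases Finset.mem_insert.mp hi with rfl | hiS
        · simpa using hself i
        · simpa [hne i hiS] using h3 i hiS
      · intro i hi k hk hki
        rcases Finset.mem_insert.mp hi with rfl | hiA
        · rcases Finset.mem_insert.mp hk with rfl | hkA
          · exact absurd rfl hki
          · rw [hsymm]; exact hex k hkA
        · rcases Finset.mem_insert.mp hk with rfl | hkA
          · have := hex i hiA
            have := hmax i (hA hiA)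
            linarith
          · exact h4 i hiA k hkA hki

lemma km_core {F D : Type*} [Fintype F] [Fintype D] [Nonempty D]
    (cF : F → D → ℝ) (cD : D → D → ℝ)
    (hF0 : ∀ i j, 0 ≤ cF i j) (hD0 : ∀ j k, 0 ≤ cD j k)
    (hsymm : ∀ j k, cD j k = cD k j)
    (tri1 : ∀ i j k, cF i j ≤ cF i k + cD k j)
    (tri2 : ∀ i j k, cD j k ≤ cF i j + cF i k)
    (f : F → ℝ) (hf : ∀ i, 0 ≤ f i)
    (fopt : ℝ) (hfopt : ∀ i, f i ≤ fopt) (hfopt0 : 0 ≤ fopt)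
    (w : F → ℝ) (B : ℝ) (hw : ∀ i, 0 ≤ w i)
    (d : D → ℝ) (hd : ∀ j, 0 ≤ d j)
    (Copt : ℝ) (hCopt : 0 ≤ Copt)
    (x : F → D → ℝ) (y : F → ℝ)
    (hx : ∀ i j, 0 ≤ x i j) (hy : ∀ i, 0 ≤ y i)
    (hx1 : ∀ j, ∑ i, x i j = 1)
    (hxy : ∀ i j, x i j ≤ y i)
    (hknap : ∑ i, w i * y i ≤ B)
    (hU : ∀ i j, 0 < x i j → ∑ k, d k * max 0 (cF i j - cD j k) ≤ Copt) :
    ∃ (Fs : Finset F) (σ : D → F),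
      (∀ j, σ j ∈ Fs) ∧
      (∑ i ∈ Fs, w i ≤ B) ∧
      (∑ i ∈ Fs, f i) + ∑ j, d j * cF (σ j) j ≤
        28 * ((∑ i, f i * y i) + ∑ j, ∑ i, d j * cF i j * x i j) + fopt + 4 * Copt := by
  obtain ⟨C, hC⟩ : ∃ C : D → ℝ, ∀ j, C j = ∑ i, cF i j * x i j := ⟨_, fun _ => rfl⟩
  have hC0 : ∀ j, 0 ≤ C j := fun j => by
    rw [hC]; exact Finset.sum_nonneg fun i _ => mul_nonneg (hF0 _ _) (hx _ _)
  have hself : ∀ j, cD j j ≤ 4 * C j := by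
    intro j
    have : cD j j ≤ 2 * C j := by
      calc cD j j = ∑ i, cD j j * x i j := by rw [← Finset.mul_sum, hx1, mul_one]
        _ ≤ ∑ i, 2 * (cF i j * x i j) := Finset.sum_le_sum fun i _ => by
            nlinarith [tri2 i j j, hx i j]
        _ = 2 * C j := by rw [hC, Finset.mul_sum]
    linarith [hC0 j]
  obtain ⟨A, a, haA, haC, hac, hsep⟩ := km_cluster C cD hsymm hself
  -- nearest neighbours
  obtain ⟨n, hn⟩ : ∃ n : D → D, ∀ j ∈ A, ∀ k ∈ A, k ≠ j →
      n j ∈ A ∧ n j ≠ j ∧ cD j (n j) ≤ cD j k := by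
    have : ∀ j, ∃ l, ∀ k ∈ A, k ≠ j → l ∈ A ∧ l ≠ j ∧ cD j l ≤ cD j k := by
      intro j
      by_cases h : (A.erase j).Nonempty
      · obtain ⟨l, hl, hmin⟩ := Finset.exists_min_image (A.erase j) (fun l => cD j l) h
        refine ⟨l, fun k hk hkj => ⟨Finset.mem_of_mem_erase hl, Finset.ne_of_mem_erase hl,
          hmin k (Finset.mem_erase.mpr ⟨hkj, hk⟩)⟩⟩
      · refine ⟨j, fun k hk hkj => ?_⟩
        exact absurd ⟨k, Finset.mem_erase.mpr ⟨hkj, hk⟩⟩ h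
    choose n hn using this
    exact ⟨n, fun j _ => hn j⟩
  obtain ⟨χ, hχ⟩ := km_color A cD hsymm n hn
  obtain ⟨δ, hδ⟩ : ∃ δ : D → ℝ, ∀ j, δ j = cD j (n j) := ⟨_, fun _ => rfl⟩
  have hδ0 : ∀ j, 0 ≤ δ j := fun j => by rw [hδ]; exact hD0 _ _
  obtain ⟨G, hG⟩ : ∃ G : D → F → Prop, ∀ j i, G j i ↔ ∀ k ∈ A, k ≠ j → 2 * cF i j < cD j k :=
    ⟨_, fun _ _ => Iff.rfl⟩
  have hnG : ∀ j ∈ A, ∀ i, ¬ G j i → 4 * C j < δ j ∧ δ j ≤ 2 * cF i j := by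
    intro j hj i hi
    rw [hG] at hi
    push Not at hi
    obtain ⟨k, hk, hkj, hle⟩ := hi
    obtain ⟨h1, h2, h3⟩ := hn j hj k hk hkj
    rw [hδ]
    exact ⟨hsep j hj _ h1 h2, h3.trans hle⟩
  obtain ⟨z, hz⟩ : ∃ z : F → D → ℝ, ∀ i j, z i j = if G j i then x i j else 0 :=
    ⟨_, fun _ _ => rfl⟩
  have hz0 : ∀ i j, 0 ≤ z i j := fun i j => by rw [hz]; split_ifs <;> simp [hx]
  have hzx : ∀ i j, z i j ≤ x i j := fun i j => by rw [hz]; split_ifs <;> simp [hx]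
  have hzpos : ∀ i j, 0 < z i j → 0 < x i j ∧ G j i := by
    intro i j h
    rw [hz] at h
    split_ifs at h with h1
    · exact ⟨h, h1⟩
    · exact absurd h (lt_irrefl _)
  obtain ⟨m, hm⟩ : ∃ m : D → ℝ, ∀ j, m j = ∑ i, z i j := ⟨_, fun _ => rfl⟩
  have hm1 : ∀ j, m j ≤ 1 := fun j => by
    rw [hm, ← hx1 j]; exact Finset.sum_le_sum fun i _ => hzx i j
  have hK : ∀ j ∈ A, ∑ i, z i j * cF i j + (1 - m j) * (δ j / 2) ≤ C j := by
    intro j hj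
    rw [hm, ← hx1 j, ← Finset.sum_sub_distrib, Finset.sum_mul, ← Finset.sum_add_distrib, hC]
    refine Finset.sum_le_sum fun i _ => ?_
    rw [hz]
    split_ifs with h
    · nlinarith
    · have := (hnG j hj i h).2
      nlinarith [hx i j]
  have hout : ∀ j ∈ A, m j < 1 → ∃ i, 0 < x i j ∧ ¬ G j i := by
    intro j hj hlt
    by_contra! h
    have : m j = 1 := by
      rw [hm, ← hx1 j]
      refine Finset.sum_congr rfl fun i _ => ?_
      rw [hz]
      split_ifs with hg
      · rfl
      · rcases (hx i j).eq_or_lt with h0 | h0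
        · exact h0
        · exact absurd (h i h0) hg
    linarith
  have hm2 : ∀ j ∈ A, 1 / 2 ≤ m j := by
    intro j hj
    by_contra! hlt
    obtain ⟨i, hi, hgi⟩ := hout j hj (by linarith)
    have h1 := (hnG j hj i hgi).1
    have h2 := hK j hj
    have h3 : 0 ≤ ∑ i, z i j * cF i j :=
      Finset.sum_nonneg fun i _ => mul_nonneg (hz0 _ _) (hF0 _ _)
    nlinarith [hC0 j]
  have hzy : ∀ i, ∑ j ∈ A, z i j ≤ y i := by
    intro i
    by_cases h : ∃ j ∈ A, G j i
    · obtain ⟨j, hj, hg⟩ := h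
      rw [Finset.sum_eq_single_of_mem j hj]
      · exact (hzx i j).trans (hxy i j)
      · intro k hk hkj
        rw [hz, if_neg]
        intro hg'
        have h1 := (hG j i).mp hg k hk hkj
        have h2 := (hG k i).mp hg' j hj hkj.symm
        rw [hsymm k j] at h2
        linarith [tri2 i j k]
    · push Not at h
      rw [Finset.sum_eq_zero]
      · exact hy i
      · intro j hj
        rw [hz, if_neg (h j hj)]
  have hzg : ∀ r : F → ℝ, (∀ i, 0 ≤ r i) →
      ∑ j : A, ∑ i, z i j * r i ≤ ∑ i, r i * y i := by
    intro r hr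
    rw [Finset.sum_coe_sort A (fun j => ∑ i, z i j * r i), Finset.sum_comm]
    refine Finset.sum_le_sum fun i _ => ?_
    rw [← Finset.sum_mul, mul_comm]
    exact mul_le_mul_of_nonneg_left (hzy i) (hr i)
  -- consolidated demands
  obtain ⟨DD, hDD⟩ : ∃ DD : D → ℝ, ∀ j, DD j = ∑ k with a k = j, d k := ⟨_, fun _ => rfl⟩
  obtain ⟨E, hE⟩ : ∃ E : D → ℝ, ∀ j, E j = ∑ k with a k = j, d k * C k := ⟨_, fun _ => rfl⟩
  obtain ⟨L, hL⟩ : ∃ L : ℝ, L = ∑ k, d k * C k := ⟨_, rfl⟩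
  have hDD0 : ∀ j, 0 ≤ DD j := fun j => by
    rw [hDD]; exact Finset.sum_nonneg fun k _ => hd k
  have hE0 : ∀ j, 0 ≤ E j := fun j => by
    rw [hE]; exact Finset.sum_nonneg fun k _ => mul_nonneg (hd k) (hC0 k)
  have hDC : ∀ j, DD j * C j ≤ E j := by
    intro j
    rw [hDD, hE, Finset.sum_mul]
    refine Finset.sum_le_sum fun k hk => ?_
    have : a k = j := by simpa using hk
    rw [← this]
    exact mul_le_mul_of_nonneg_left (haC k) (hd k)
  have hEL : ∑ j : A, E j = L := by
    rw [Finset.sum_coe_sort A E, hL]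
    simp only [hE]
    exact Finset.sum_fiberwise_of_maps_to (fun k _ => haA k) _
  have hEle : ∀ j : A, E j ≤ L := fun j => by
    rw [← hEL]
    exact Finset.single_le_sum (f := fun j : A => E j) (fun k _ => hE0 k) (mem_univ j)
  have hL0 : 0 ≤ L := by
    rw [hL]; exact Finset.sum_nonneg fun k _ => mul_nonneg (hd k) (hC0 k)
  have hUD : ∀ i j, 0 < x i j → DD j * cF i j ≤ Copt + 4 * E j := by
    intro i j hij
    have h1 : ∑ k with a k = j, d k * max 0 (cF i j - cD j k) ≤ Copt :=
      (Finset.sum_le_sum_of_subset_of_nonneg (Finset.filter_subset _ _)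
        (fun k _ _ => mul_nonneg (hd k) (le_max_left _ _))).trans (hU i j hij)
    have h2 : DD j * cF i j ≤
        ∑ k with a k = j, d k * max 0 (cF i j - cD j k) + 4 * E j := by
      rw [hDD, hE, Finset.sum_mul, Finset.mul_sum, ← Finset.sum_add_distrib]
      refine Finset.sum_le_sum fun k hk => ?_
      have hak : a k = j := by simpa using hk
      have h3 := hac k
      rw [hak] at h3
      have h4 := le_max_right 0 (cF i j - cD j k)
      nlinarith [hd k]
    linarith
  -- the multiple-choice knapsack
  have hAne : Nonempty A := by
    obtain ⟨k⟩ := ‹Nonempty D›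
    exact ⟨⟨a k, haA k⟩⟩
  let p : A × Bool → Option F → ℝ := fun g o =>
    if g.2 then o.elim (2 - 2 * m g.1) (fun i => z i g.1 * (2 - 1 / m g.1))
    else o.elim 0 (fun i => z i g.1 * (1 / m g.1))
  let cost : A → Option F → ℝ := fun j o =>
    o.elim (DD j * (3 / 2 * δ j)) (fun i => f i + DD j * cF i j)
  let ext : (F → ℝ) → Option F → ℝ := fun r o => o.elim 0 r
  have hmpos : ∀ j : A, 0 < m j := fun j => by linarith [hm2 j j.2]
  have hminv : ∀ j : A, 1 / m j ≤ 2 := fun j => by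
    rw [div_le_iff₀ (hmpos j)]; linarith [hm2 j j.2]
  have hp0 : ∀ g o, 0 ≤ p g o := by
    rintro ⟨j, b⟩ o
    have h1 := hm1 j
    have h2 := hminv j
    have h3 := hmpos j
    cases b <;> cases o <;> simp only [p, Option.elim, if_true, Bool.false_eq_true, if_false]
    · exact le_rfl
    · exact mul_nonneg (hz0 _ _) (by positivity)
    · linarith
    · exact mul_nonneg (hz0 _ _) (by linarith)
  have hp1 : ∀ g, ∑ o, p g o = 1 := by
    rintro ⟨j, b⟩
    have h3 := (hmpos j).ne'
    cases b <;> rw [Fintype.sum_option] <;>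
      simp only [p, Option.elim, if_true, Bool.false_eq_true, if_false] <;>
      rw [← Finset.sum_mul, ← hm] <;> field_simp <;> ring
  have hpe : ∀ r : A → Option F → ℝ, ∑ g, ∑ o, p g o * r g.1 o =
      ∑ j : A, (∑ i, 2 * (z i j * r j (some i)) + (2 - 2 * m j) * r j none) := by
    intro r
    rw [Fintype.sum_prod_type]
    refine Finset.sum_congr rfl fun j _ => ?_
    rw [Fintype.sum_bool, Fintype.sum_option, Fintype.sum_option]
    simp only [p, Option.elim, if_true, Bool.false_eq_true, if_false]
    have : ∑ i, 2 * (z i j * r j (some i)) =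
        ∑ i, z i j * (2 - 1 / m j) * r j (some i) + ∑ i, z i j * (1 / m j) * r j (some i) := by
      rw [← Finset.sum_add_distrib]
      exact Finset.sum_congr rfl fun i _ => by ring
    rw [this]; ring
  have hcost0 : ∀ j o, 0 ≤ cost j o := by
    intro j o
    cases o <;> simp only [cost, Option.elim]
    · exact mul_nonneg (hDD0 _) (by linarith [hδ0 j])
    · exact add_nonneg (hf _) (mul_nonneg (hDD0 _) (hF0 _ _))
  obtain ⟨o, ho, how, g0, hoc⟩ := km_choice (fun g o => ext w o) (fun g : A × Bool => cost g.1)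
    (fun g => hcost0 g.1) _ p hp0 hp1 le_rfl
  rw [hpe (fun _ => ext w)] at how
  rw [hpe cost] at hoc
  -- facts about chosen options
  have hsome : ∀ g i, o g = some i → 0 < x i g.1 ∧ G g.1 i := by
    rintro ⟨j, b⟩ i hi
    have h := ho (j, b)
    rw [hi] at h
    apply hzpos
    rcases (hz0 i j).eq_or_lt with h0 | h0
    · exfalso
      cases b <;> simp [p, ← h0] at h
    · exact h0
  have hfst : ∀ j, ∃ i, o (j, false) = some i := by
    intro j
    rcases h : o (j, false) with _ | i
    · have h' := ho (j, false)
      rw [h] at h'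
      simp [p] at h'
    · exact ⟨i, rfl⟩
  have hnone : ∀ g, o g = none → ∃ i, 0 < x i g.1 ∧ ¬ G g.1 i := by
    rintro ⟨j, b⟩ h
    have h' := ho (j, b)
    rw [h] at h'
    apply hout j j.2
    cases b
    · simp [p] at h'
    · simp [p] at h'
      linarith
  have hbad : ∀ g, cost g.1 (o g) ≤ fopt + 3 * Copt + 12 * L := by
    intro g
    have hEg := hEle g.1
    rcases h : o g with _ | i
    · obtain ⟨i, hi, hgi⟩ := hnone g h
      have h1 := hUD i g.1 hi
      have h2 := (hnG g.1 g.1.2 i hgi).2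
      simp only [cost, Option.elim]
      nlinarith [hDD0 g.1]
    · have h1 := hUD i g.1 (hsome g i h).1
      simp only [cost, Option.elim]
      linarith [hfopt i]
  have htot : ∑ g, cost g.1 (o g) ≤ 2 * ∑ i, f i * y i + 18 * L + fopt + 3 * Copt := by
    have h1 : ∑ j : A, (∑ i, 2 * (z i j * cost j (some i)) + (2 - 2 * m j) * cost j none) ≤
        2 * ∑ i, f i * y i + 6 * L := by
      have h2 : ∀ j : A, (∑ i, 2 * (z i j * cost j (some i)) + (2 - 2 * m j) * cost j none) ≤
          2 * ∑ i, z i j * f i + 6 * E j := by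
        intro j
        have h3 : ∑ i, 2 * (z i j * cost j (some i)) =
            2 * ∑ i, z i j * f i + 2 * DD j * ∑ i, z i j * cF i j := by
          rw [Finset.mul_sum, Finset.mul_sum, ← Finset.sum_add_distrib]
          refine Finset.sum_congr rfl fun i _ => ?_
          simp only [cost, Option.elim]; ring
        rw [h3]
        simp only [cost, Option.elim]
        have h4 := mul_le_mul_of_nonneg_left (hK j j.2) (hDD0 j)
        have h5 : 0 ≤ DD j * ∑ i, z i j * cF i j := mul_nonneg (hDD0 j)
          (Finset.sum_nonneg fun i _ => mul_nonneg (hz0 _ _) (hF0 _ _))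
        have h6 := hDC j
        nlinarith
      calc _ ≤ ∑ j : A, (2 * ∑ i, z i j * f i + 6 * E j) := Finset.sum_le_sum fun j _ => h2 j
        _ = 2 * ∑ j : A, ∑ i, z i j * f i + 6 * L := by
            rw [Finset.sum_add_distrib, ← Finset.mul_sum, ← Finset.mul_sum, hEL]
        _ ≤ _ := by linarith [hzg f hf]
    have h7 : ∑ g, cost g.1 (o g) =
        cost g0.1 (o g0) + ∑ g ∈ univ.erase g0, cost g.1 (o g) :=
      (Finset.add_sum_erase univ (fun g : A × Bool => cost g.1 (o g)) (mem_univ g0)).symm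
    have h8 : ∑ g ∈ univ.erase g0, cost g.1 (o g) ≤ 2 * ∑ i, f i * y i + 6 * L := by
      refine le_trans (le_of_eq ?_) (hoc.trans h1)
      congr!
    rw [h7]
    linarith [hbad g0]
  have hwt : ∑ g, ext w (o g) ≤ 2 * B := by
    refine how.trans ?_
    have : ∑ j : A, (∑ i, 2 * (z i j * ext w (some i)) + (2 - 2 * m j) * ext w none) =
        2 * ∑ j : A, ∑ i, z i j * w i := by
      rw [Finset.mul_sum]
      refine Finset.sum_congr rfl fun j _ => ?_
      simp [ext, Finset.mul_sum]
    rw [this]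
    linarith [hzg w hw]
  -- two complementary integral solutions
  let ch : Bool → A → Option F := fun b j => o (j, xor b (χ j))
  have hchsum : ∀ r : A → Option F → ℝ,
      ∑ j, r j (ch true j) + ∑ j, r j (ch false j) = ∑ g, r g.1 (o g) := by
    intro r
    rw [Fintype.sum_prod_type, ← Finset.sum_add_distrib]
    refine Finset.sum_congr rfl fun j _ => ?_
    rw [Fintype.sum_bool]
    simp only [ch]
    cases χ j <;> simp [add_comm]
  obtain ⟨b, hb⟩ : ∃ b, ∑ j, ext w (ch b j) ≤ B := by
    by_contra! h
    have h1 := hchsum (fun _ => ext w)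
    linarith [h true, h false]
  let Fs : Finset F := univ.filter fun i => ∃ j, ch b j = some i
  have hFs : ∀ r : F → ℝ, (∀ i, 0 ≤ r i) → ∑ i ∈ Fs, r i ≤ ∑ j, ext r (ch b j) := by
    intro r hr
    calc ∑ i ∈ Fs, r i ≤ ∑ i ∈ Fs, ∑ j, (if ch b j = some i then r i else 0) := by
          refine Finset.sum_le_sum fun i hi => ?_
          obtain ⟨j, hj⟩ : ∃ j, ch b j = some i := by simpa [Fs] using hi
          have := Finset.single_le_sum (f := fun j => if ch b j = some i then r i else 0)
            (fun k _ => by split_ifs <;> simp [hr]) (mem_univ j)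
          simpa [hj] using this
      _ = ∑ j, ∑ i ∈ Fs, (if ch b j = some i then r i else 0) := Finset.sum_comm
      _ ≤ _ := by
          refine Finset.sum_le_sum fun j _ => ?_
          rcases h : ch b j with _ | i
          · simp [ext]
          · simp only [Option.some.injEq, ext, Option.elim]
            rw [Finset.sum_ite_eq]
            split_ifs <;> simp [hr]
  -- every centre has a nearby open facility
  have hopen : ∀ j : A, ∃ i ∈ Fs, DD j * cF i j + (ext f (o (j, true)) + ext f (o (j, false))) ≤
      cost j (o (j, true)) + cost j (o (j, false)) := by
    intro j
    obtain ⟨i1, hi1⟩ := hfst j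
    rcases h2 : o (j, true) with _ | i2
    · obtain ⟨i', hi', hgi'⟩ := hnone _ h2
      have hex : ∃ k ∈ A, k ≠ (j : D) := by
        rw [hG] at hgi'
        push Not at hgi'
        obtain ⟨k, hk, hkj, _⟩ := hgi'
        exact ⟨k, hk, hkj⟩
      obtain ⟨k, hk, hkj⟩ := hex
      rw [hi1]
      simp only [cost, ext, Option.elim]
      suffices h : ∃ i ∈ Fs, cF i j ≤ 3 / 2 * δ j + cF i1 j by
        obtain ⟨i, hi, hle⟩ := h
        refine ⟨i, hi, ?_⟩
        nlinarith [mul_le_mul_of_nonneg_left hle (hDD0 j)]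
      by_cases hcol : xor b (χ j) = false
      · refine ⟨i1, ?_, by linarith [hδ0 j]⟩
        simp only [Fs, mem_filter, mem_univ, true_and]
        exact ⟨j, by simp only [ch]; rw [hcol, hi1]⟩
      · obtain ⟨l, hl, hlχ, hlc⟩ := hχ j j.2 k hk hkj
        have hlj : (j : D) ≠ l := by intro h; rw [← h] at hlχ; exact hlχ rfl
        obtain ⟨il, hil⟩ := hfst ⟨l, hl⟩
        have hcol' : xor b (χ l) = false := by
          revert hcol hlχ
          cases b <;> cases χ l <;> cases χ (j : D) <;> simp
        refine ⟨il, ?_, ?_⟩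
        · simp only [Fs, mem_filter, mem_univ, true_and]
          exact ⟨⟨l, hl⟩, by simp only [ch]; rw [hcol', hil]⟩
        · have h5 := (hG _ _).mp (hsome _ _ hil).2 j j.2 hlj
          simp only at h5
          have h6 := tri1 il j l
          rw [hsymm l j] at h5 h6
          rw [← hδ] at hlc
          linarith [hF0 i1 j]
    · rw [hi1]
      simp only [cost, ext, Option.elim]
      suffices h : ∃ i ∈ Fs, cF i j ≤ cF i1 j + cF i2 j by
        obtain ⟨i, hi, hle⟩ := h
        refine ⟨i, hi, ?_⟩
        nlinarith [mul_le_mul_of_nonneg_left hle (hDD0 j)]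
      rcases hcol : xor b (χ j) with _ | _
      · refine ⟨i1, ?_, by linarith [hF0 i2 j]⟩
        simp only [Fs, mem_filter, mem_univ, true_and]
        exact ⟨j, by simp only [ch]; rw [hcol, hi1]⟩
      · refine ⟨i2, ?_, by linarith [hF0 i1 j]⟩
        simp only [Fs, mem_filter, mem_univ, true_and]
        exact ⟨j, by simp only [ch]; rw [hcol, h2]⟩
  choose s hsF hsc using hopen
  refine ⟨Fs, fun k => s ⟨a k, haA k⟩, fun k => hsF _, (hFs w hw).trans hb, ?_⟩
  have hFf : ∑ i ∈ Fs, f i ≤ ∑ g, ext f (o g) := by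
    refine (hFs f hf).trans ?_
    rw [← hchsum (fun _ => ext f)]
    have h0 : ∀ b', 0 ≤ ∑ j, ext f (ch b' j) := fun b' => Finset.sum_nonneg fun j _ => by
      rcases ch b' j with _ | i <;> simp [ext, hf]
    cases b
    · linarith [h0 true]
    · linarith [h0 false]
  have hconn : ∑ k, d k * cF (s ⟨a k, haA k⟩) k ≤ ∑ j : A, DD j * cF (s j) j + 4 * L := by
    have h1 : ∑ k, d k * cF (s ⟨a k, haA k⟩) (a k) = ∑ j : A, DD j * cF (s j) j := by
      rw [← Finset.sum_fiberwise_of_maps_to (g := fun k => (⟨a k, haA k⟩ : A))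
        (t := univ) (fun k _ => mem_univ _)]
      refine Finset.sum_congr rfl fun j _ => ?_
      rw [hDD, Finset.sum_mul]
      refine Finset.sum_congr ?_ ?_
      · ext k
        simp [Subtype.ext_iff]
      · intro k hk
        have hk' : a k = j := by simpa using hk
        have : (⟨a k, haA k⟩ : A) = j := Subtype.ext hk'
        rw [this, hk']
    rw [← h1, hL, Finset.mul_sum, ← Finset.sum_add_distrib]
    refine Finset.sum_le_sum fun k _ => ?_
    nlinarith [tri1 (s ⟨a k, haA k⟩) k (a k), hac k, hd k]
  have hsum : ∑ j : A, DD j * cF (s j) j + ∑ g, ext f (o g) ≤ ∑ g, cost g.1 (o g) := by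
    rw [Fintype.sum_prod_type, Fintype.sum_prod_type, ← Finset.sum_add_distrib]
    refine Finset.sum_le_sum fun j _ => ?_
    rw [Fintype.sum_bool, Fintype.sum_bool]
    exact hsc j
  have hLL : ∑ j, ∑ i, d j * cF i j * x i j = L := by
    rw [hL]
    refine Finset.sum_congr rfl fun j _ => ?_
    rw [hC, Finset.mul_sum]
    exact Finset.sum_congr rfl fun i _ => by ring
  rw [hLL]
  have hfy : 0 ≤ ∑ i, f i * y i := Finset.sum_nonneg fun i _ => mul_nonneg (hf i) (hy i)
  linarith

/-- Theorem C.4 / Corollary C.5: rounding a fractional solution of the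
strengthened knapsack-median LP (K-P).  The constraint `x_{ij} = 0 whenever
c(i,j) > U_j`, where `U_j = sup { z ≥ 0 : ∑_k d_k max(0, z − c(j,k)) ≤ C^opt }`
(possibly `U_j = ∞`), is expressed by saying that `x i j = 0` whenever some
upper bound `b` of this set satisfies `b < c(i,j)`. -/
theorem knapsack_median_rounding
    {F D : Type*} [Fintype F] [Fintype D]
    (c : F ⊕ D → F ⊕ D → ℝ)
    (hc_nonneg : ∀ u v, 0 ≤ c u v)
    (hc_symm : ∀ u v, c u v = c v u)
    (hc_tri : ∀ u v w, c u w ≤ c u v + c v w)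
    (f : F → ℝ) (hf : ∀ i, 0 ≤ f i)
    (fopt : ℝ) (hfopt : ∀ i, f i ≤ fopt) (hfopt0 : 0 ≤ fopt)
    (w : F → ℝ) (B : ℝ) (hB : 0 ≤ B)
    (hw : ∀ i, 0 ≤ w i) (hwB : ∀ i, w i ≤ B)
    (d : D → ℝ) (hd : ∀ j, 0 ≤ d j)
    (Copt : ℝ) (hCopt : 0 ≤ Copt)
    (x : F → D → ℝ) (y : F → ℝ)
    (hx : ∀ i j, 0 ≤ x i j) (hy : ∀ i, 0 ≤ y i)
    (hx1 : ∀ j, 1 ≤ ∑ i, x i j)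
    (hxy : ∀ i j, x i j ≤ y i)
    (hknap : ∑ i, w i * y i ≤ B)
    -- x_{ij} = 0 whenever c(i,j) > U_j
    (hxU : ∀ i j,
      (∃ b : ℝ, (∀ z : ℝ, 0 ≤ z →
          (∑ k, d k * max 0 (z - c (Sum.inr j) (Sum.inr k))) ≤ Copt → z ≤ b) ∧
        b < c (Sum.inl i) (Sum.inr j)) → x i j = 0) :
    ∃ (Fs : Finset F) (σ : D → F),
      (∀ j, σ j ∈ Fs) ∧
      (∑ i ∈ Fs, w i ≤ B) ∧
      (∑ i ∈ Fs, f i) + ∑ j, d j * c (Sum.inl (σ j)) (Sum.inr j) ≤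
        28 * ((∑ i, f i * y i) +
            ∑ j, ∑ i, d j * c (Sum.inl i) (Sum.inr j) * x i j) +
          fopt + 4 * Copt := by
  rcases isEmpty_or_nonempty D with hD | hD
  · refine ⟨∅, fun j => hD.elim j, fun j => hD.elim j, by simpa using hB, ?_⟩
    have hfy : 0 ≤ ∑ i, f i * y i := Finset.sum_nonneg fun i _ => mul_nonneg (hf i) (hy i)
    simp
    linarith
  have hspos : ∀ j, 0 < ∑ i, x i j := fun j => lt_of_lt_of_le one_pos (hx1 j)
  have hle : ∀ i j, x i j / (∑ i, x i j) ≤ x i j := fun i j => div_le_self (hx i j) (hx1 j)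
  have hU : ∀ i j, 0 < x i j →
      ∑ k, d k * max 0 (c (Sum.inl i) (Sum.inr j) - c (Sum.inr j) (Sum.inr k)) ≤ Copt := by
    intro i j hij
    have hcont : Continuous fun z : ℝ => ∑ k, d k * max 0 (z - c (Sum.inr j) (Sum.inr k)) := by
      fun_prop
    refine le_of_tendsto (x := nhdsWithin (c (Sum.inl i) (Sum.inr j))
      (Set.Iio (c (Sum.inl i) (Sum.inr j)))) (hcont.continuousAt.tendsto.mono_left
        nhdsWithin_le_nhds) ?_
    filter_upwards [self_mem_nhdsWithin] with b hb
    have hno : ¬ ∀ z : ℝ, 0 ≤ z →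
          (∑ k, d k * max 0 (z - c (Sum.inr j) (Sum.inr k))) ≤ Copt → z ≤ b := by
      intro h
      exact hij.ne' (hxU i j ⟨b, h, hb⟩)
    push Not at hno
    obtain ⟨z, _, hz, hbz⟩ := hno
    refine le_trans (Finset.sum_le_sum fun k _ => ?_) hz
    exact mul_le_mul_of_nonneg_left (max_le_max le_rfl (by linarith)) (hd k)
  obtain ⟨Fs, σ, h1, h2, h3⟩ := km_core (fun i j => c (Sum.inl i) (Sum.inr j))
    (fun j k => c (Sum.inr j) (Sum.inr k)) (fun _ _ => hc_nonneg _ _) (fun _ _ => hc_nonneg _ _)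
    (fun _ _ => hc_symm _ _) (fun _ _ _ => hc_tri _ _ _)
    (fun i j k => by
      have := hc_tri (Sum.inr j) (Sum.inl i) (Sum.inr k)
      rwa [hc_symm (Sum.inr j) (Sum.inl i)] at this)
    f hf fopt hfopt hfopt0 w B hw d hd Copt hCopt (fun i j => x i j / ∑ i, x i j) y
    (fun i j => div_nonneg (hx i j) (hspos j).le) hy
    (fun j => by rw [← Finset.sum_div, div_self (hspos j).ne'])
    (fun i j => (hle i j).trans (hxy i j)) hknap
    (fun i j h => hU i j (h.trans_le (hle i j)))
  refine ⟨Fs, σ, h1, h2, h3.trans ?_⟩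
  have : ∑ j, ∑ i, d j * c (Sum.inl i) (Sum.inr j) * (x i j / ∑ i, x i j) ≤
      ∑ j, ∑ i, d j * c (Sum.inl i) (Sum.inr j) * x i j :=
    Finset.sum_le_sum fun j _ => Finset.sum_le_sum fun i _ =>
      mul_le_mul_of_nonneg_left (hle i j) (mul_nonneg (hd j) (hc_nonneg _ _))
  linarith
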